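/- arXiv:2108.07953 — 4 statements merged into one kernel-verified Lean document; each statement's English description precedes it below -/
import Mathlib

section
/- Let a > 0, b ∈ ℝ, P_max > 0, and let P_RIS satisfy 0 ≤ P_RIS < P_max. Let f be the nonlinear energy-harvesting model with parameters a, b, P_max. Then: (i) P_max/(P_RIS·(1 − 1/(1 + exp(a·b))) + P_max/(1 + exp(a·b))) − 1 > 0; and (ii) for every x ∈ ℝ, f(x) ≥ P_RIS if and only if x ≥ b − (1/a)·log(P_max/(P_RIS·(1 − 1/(1 + exp(a·b))) + P_max/(1 + exp(a·b))) − 1). -/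
/-- The nonlinear energy-harvesting model with parameters `a`, `b`, `Pmax` (eq. (6)). -/
noncomputable def ehModel (a b Pmax : ℝ) (x : ℝ) : ℝ :=
  (Pmax / (1 + Real.exp (-a * (x - b))) - Pmax / (1 + Real.exp (a * b))) /
    (1 - 1 / (1 + Real.exp (a * b)))

/-- Inversion of the energy-harvesting model: the harvested DC power covers the demand
`PRIS` precisely when the RF input power exceeds the stated threshold. -/
theorem stmt_3 (a b Pmax PRIS : ℝ) (ha : 0 < a) (hPmax : 0 < Pmax)
    (hPRIS0 : 0 ≤ PRIS) (hPRIS : PRIS < Pmax) :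
    0 < Pmax / (PRIS * (1 - 1 / (1 + Real.exp (a * b))) + Pmax / (1 + Real.exp (a * b))) - 1 ∧
    ∀ x : ℝ, ehModel a b Pmax x ≥ PRIS ↔
      x ≥ b - (1 / a) * Real.log
        (Pmax / (PRIS * (1 - 1 / (1 + Real.exp (a * b))) + Pmax / (1 + Real.exp (a * b))) - 1) := by
  have hE : 0 < Real.exp (a * b) := Real.exp_pos _
  have hΩ : 0 < 1 - 1 / (1 + Real.exp (a * b)) := by
    rw [sub_pos, div_lt_one (by positivity)]
    linarith
  set D := PRIS * (1 - 1 / (1 + Real.exp (a * b))) + Pmax / (1 + Real.exp (a * b)) with hD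
  have hD0 : 0 < D := by positivity
  have hDP : D < Pmax := by
    have h := mul_lt_mul_of_pos_right hPRIS hΩ
    have h' : Pmax * (1 - 1 / (1 + Real.exp (a * b))) + Pmax / (1 + Real.exp (a * b)) = Pmax := by
      ring
    linarith
  have hpos : 0 < Pmax / D - 1 := by
    rw [sub_pos, one_lt_div hD0]
    exact hDP
  refine ⟨hpos, fun x => ?_⟩
  have he : 0 < 1 + Real.exp (-a * (x - b)) := by positivity
  calc ehModel a b Pmax x ≥ PRIS
      ↔ D ≤ Pmax / (1 + Real.exp (-a * (x - b))) := by
        rw [ehModel, ge_iff_le, le_div_iff₀ hΩ, le_sub_iff_add_le]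
    _ ↔ Real.exp (-a * (x - b)) ≤ Pmax / D - 1 := by
        rw [le_div_comm₀ hD0 he, le_sub_iff_add_le']
    _ ↔ -a * (x - b) ≤ Real.log (Pmax / D - 1) := (Real.le_log_iff_exp_le hpos).symm
    _ ↔ x ≥ b - 1 / a * Real.log (Pmax / D - 1) := by
        rw [ge_iff_le, sub_le_comm, one_div_mul_eq_div, le_div_iff₀ ha]
        ring_nf
end

section
/- Let a > 0, b ∈ ℝ, P_max > 0, 0 ≤ P_RIS < P_max, and η > 0, P_t > 0, β > 0. Let f be the nonlinear energy-harvesting model with parameters a, b, P_max, and set Q := P_max/(P_RIS·(1 − 1/(1 + exp(a·b))) + P_max/(1 + exp(a·b))). Then for every natural number m: f(η·P_t·β·m) ≥ P_RIS if and only if (m : ℤ) ≥ ⌈(b − (1/a)·log(Q − 1)) / (η·P_t·β)⌉, where ⌈·⌉ is the integer ceiling. -/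
/-- The harvested power meets the demand `PRIS` iff the input power is at least the inverse of the
harvesting model at `PRIS`. -/
theorem ehModel_ge_iff {a b Pmax PRIS : ℝ} (ha : 0 < a) (hPmax : 0 < Pmax)
    (hPRIS0 : 0 ≤ PRIS) (hPRIS : PRIS < Pmax) (x : ℝ) :
    PRIS ≤ ehModel a b Pmax x ↔
      b - (1 / a) * Real.log
        (Pmax / (PRIS * (1 - 1 / (1 + Real.exp (a * b))) + Pmax / (1 + Real.exp (a * b))) - 1)
        ≤ x := by
  have hE := Real.exp_pos (a * b)
  have hD : 0 < 1 - 1 / (1 + Real.exp (a * b)) := by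
    rw [sub_pos, div_lt_one (by linarith)]
    linarith
  unfold ehModel
  have hu := Real.exp_pos (-a * (x - b))
  rw [le_div_iff₀ hD, le_sub_iff_add_le]
  have hT : 0 < PRIS * (1 - 1 / (1 + Real.exp (a * b))) + Pmax / (1 + Real.exp (a * b)) := by
    positivity
  have hTP : PRIS * (1 - 1 / (1 + Real.exp (a * b))) + Pmax / (1 + Real.exp (a * b)) < Pmax := by
    have h := mul_lt_mul_of_pos_right hPRIS hD
    have h' : Pmax / (1 + Real.exp (a * b)) = Pmax * (1 / (1 + Real.exp (a * b))) := by ring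
    rw [h']
    linarith
  generalize PRIS * (1 - 1 / (1 + Real.exp (a * b))) + Pmax / (1 + Real.exp (a * b)) = T at *
  have hQ : 0 < Pmax / T - 1 := by
    rw [sub_pos, one_lt_div hT]
    exact hTP
  rw [le_div_comm₀ hT (by linarith), ← le_sub_iff_add_le', ← Real.le_log_iff_exp_le hQ,
    one_div_mul_eq_div, sub_le_comm, le_div_iff₀ ha]
  constructor <;> intro h <;> linarith

/-- Under equal-gain propagation, `m` harvesting unit cells (each contributing RF power
`η·P_t·β`) meet the RIS power demand `PRIS` iff `m` is at least the ceiling in eq. (26). -/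
theorem stmt_4 (a b Pmax PRIS η Pt β : ℝ) (ha : 0 < a) (hPmax : 0 < Pmax)
    (hPRIS0 : 0 ≤ PRIS) (hPRIS : PRIS < Pmax) (hη : 0 < η) (hPt : 0 < Pt) (hβ : 0 < β) :
    ∀ m : ℕ, ehModel a b Pmax (η * Pt * β * m) ≥ PRIS ↔
      (m : ℤ) ≥
        ⌈(b - (1 / a) * Real.log
            (Pmax / (PRIS * (1 - 1 / (1 + Real.exp (a * b))) + Pmax / (1 + Real.exp (a * b)))
              - 1)) / (η * Pt * β)⌉ := by
  intro m
  have hk : 0 < η * Pt * β := by positivity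
  rw [ge_iff_le, ge_iff_le, ehModel_ge_iff ha hPmax hPRIS0 hPRIS, Int.ceil_le, Int.cast_natCast,
    div_le_iff₀' hk]
end

section
/- Let M be a natural number and r : Fin M → ℝ. If T and T' are top sets for r with card T = card T', then ∑_{i∈T} r(i) = ∑_{i∈T'} r(i). -/
/-- `T` is a top set for `r` if every element of `T` has a value of `r` at least as
large as every element outside `T`. -/
def IsTopSet {M : ℕ} (r : Fin M → ℝ) (T : Finset (Fin M)) : Prop :=
  ∀ i ∈ T, ∀ j ∉ T, r j ≤ r i

/-- A top set maximizes the sum among all sets of its cardinality. -/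
theorem IsTopSet.sum_le_sum_of_card_eq {M : ℕ} {r : Fin M → ℝ} {S T : Finset (Fin M)}
    (hT : IsTopSet r T) (hcard : S.card = T.card) : ∑ i ∈ S, r i ≤ ∑ i ∈ T, r i := by
  have hsdiff : (S \ T).card = (T \ S).card := Finset.card_sdiff_comm hcard
  rw [← Finset.sum_sdiff_le_sum_sdiff]
  rcases (S \ T).eq_empty_or_nonempty with hS | hS
  · have hTS : T \ S = ∅ := by
      rw [← Finset.card_eq_zero, ← hsdiff, hS, Finset.card_empty]
    rw [hS, hTS]
  · obtain ⟨a, ha, hmax⟩ := Finset.exists_max_image (S \ T) r hS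
    calc ∑ i ∈ S \ T, r i ≤ (S \ T).card • r a := Finset.sum_le_card_nsmul _ _ _ hmax
      _ = (T \ S).card • r a := by rw [hsdiff]
      _ ≤ ∑ i ∈ T \ S, r i := Finset.card_nsmul_le_sum _ _ _ fun i hi =>
          hT i (Finset.mem_sdiff.mp hi).1 a (Finset.mem_sdiff.mp ha).2

/-- Tie-breaking independence: two top sets of the same cardinality have equal gain sums. -/
theorem stmt_6 (M : ℕ) (r : Fin M → ℝ) (T T' : Finset (Fin M))
    (hT : IsTopSet r T) (hT' : IsTopSet r T') (hcard : T.card = T'.card) :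
    ∑ i ∈ T, r i = ∑ i ∈ T', r i := by
  exact le_antisymm (hT'.sum_le_sum_of_card_eq hcard) (hT.sum_le_sum_of_card_eq hcard.symm)
end

section
/- (Proposition 2) Fix a natural number M, reals β > 0, η > 0, P_t > 0, σ > 0, γ₀ ∈ ℝ, b ∈ ℝ, a > 0, and P_max > 0. Let f be the nonlinear energy-harvesting model with parameters a, b, P_max, and let r : Fin M → ℝ satisfy r(k) ≥ 0 for all k. For a finset S of Fin M write SNR(S) := (P_t/σ²)·β·(∑_{k∈S} r(k))². Suppose T and T' are top sets for r with T' ⊆ T, card T' = card T − 1, card T ≥ 1, SNR(T) ≥ γ₀, and SNR(T') < γ₀. Then for every finset S of Fin M with SNR(S) ≥ γ₀ one has card S ≥ card T, and consequently f(η·P_t·β·(M − card S)) ≤ f(η·P_t·β·(M − card T)). Hence, under equal-gain propagation in the TX-RIS link, choosing the reflecting set to be the minimal-cardinality set of unit cells with the largest RIS-RX gains that meets the SNR constraint, and dedicating all remaining unit cells to harvesting, maximizes the harvested DC power subject to SNR(A_r) ≥ γ₀. -/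
/-- The nonlinear energy-harvesting model is monotone in the input power. -/
theorem ehModel_monotone {a Pmax : ℝ} (b : ℝ) (ha : 0 ≤ a) (hPmax : 0 ≤ Pmax) :
    Monotone (ehModel a b Pmax) := by
  intro x y hxy
  have hden : 0 ≤ 1 - 1 / (1 + Real.exp (a * b)) := by
    rw [sub_nonneg]
    exact div_le_one_of_le₀ (by linarith [Real.exp_pos (a * b)]) (by positivity)
  have hexp : -a * (y - b) ≤ -a * (x - b) := by nlinarith
  unfold ehModel
  gcongr

/-- A top set has the largest sum of nonnegative values among all sets of at most its size. -/
theorem IsTopSet.sum_le_sum {M : ℕ} {r : Fin M → ℝ} {S T : Finset (Fin M)}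
    (hT : IsTopSet r T) (hr : ∀ k, 0 ≤ r k) (hcard : S.card ≤ T.card) :
    ∑ k ∈ S, r k ≤ ∑ k ∈ T, r k := by
  rw [← Finset.sum_sdiff_le_sum_sdiff]
  have hc : (S \ T).card ≤ (T \ S).card := Finset.card_sdiff_le_card_sdiff_iff.mpr hcard
  rcases (T \ S).eq_empty_or_nonempty with h | h
  · have h' : S \ T = ∅ := by simpa [h] using hc
    simp [h, h']
  · obtain ⟨m, hm, hmin⟩ := Finset.exists_min_image _ r h
    calc ∑ k ∈ S \ T, r k ≤ (S \ T).card • r m :=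
          Finset.sum_le_card_nsmul _ _ _ fun j hj =>
            hT m (Finset.mem_sdiff.mp hm).1 j (Finset.mem_sdiff.mp hj).2
      _ ≤ (T \ S).card • r m := nsmul_le_nsmul_left (hr m) hc
      _ ≤ ∑ k ∈ T \ S, r k := Finset.card_nsmul_le_sum _ _ _ hmin

/-- Proposition 2: under equal-gain propagation in the TX-RIS link, the
minimal-cardinality top set meeting the SNR constraint maximizes the harvested DC power:
every feasible reflecting set `S` has at least `card T` elements, hence harvests no more
DC power than the allocation based on `T`. -/
theorem stmt_9 (M : ℕ) (β η Pt σ γ₀ b a Pmax : ℝ)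
    (hβ : 0 < β) (hη : 0 < η) (hPt : 0 < Pt) (hσ : 0 < σ) (ha : 0 < a) (hPmax : 0 < Pmax)
    (r : Fin M → ℝ) (hr : ∀ k, 0 ≤ r k)
    (T T' : Finset (Fin M)) (hT : IsTopSet r T) (hT' : IsTopSet r T')
    (hsub : T' ⊆ T) (hcard' : T'.card = T.card - 1) (hT1 : 1 ≤ T.card)
    (hTfeas : (Pt / σ ^ 2) * β * (∑ k ∈ T, r k) ^ 2 ≥ γ₀)
    (hT'infeas : (Pt / σ ^ 2) * β * (∑ k ∈ T', r k) ^ 2 < γ₀) :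
    ∀ S : Finset (Fin M), (Pt / σ ^ 2) * β * (∑ k ∈ S, r k) ^ 2 ≥ γ₀ →
      T.card ≤ S.card ∧
      ehModel a b Pmax (η * Pt * β * ((M : ℝ) - (S.card : ℝ))) ≤
        ehModel a b Pmax (η * Pt * β * ((M : ℝ) - (T.card : ℝ))) := by
  intro S hS
  have hle : T.card ≤ S.card := by
    by_contra! hlt
    have hsum : ∑ k ∈ S, r k ≤ ∑ k ∈ T', r k := hT'.sum_le_sum hr (by omega)
    have hnonneg : 0 ≤ ∑ k ∈ S, r k := Finset.sum_nonneg fun k _ => hr k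
    have hsnr : (Pt / σ ^ 2) * β * (∑ k ∈ S, r k) ^ 2 ≤
        (Pt / σ ^ 2) * β * (∑ k ∈ T', r k) ^ 2 := by gcongr
    linarith
  refine ⟨hle, ehModel_monotone b ha.le hPmax.le ?_⟩
  gcongr
end
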